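/- arXiv:1307.6134 — 7 statements merged into one kernel-verified Lean document; each statement's English description precedes it below -/
import Mathlib

section
/- For every α ∈ (0, 1/√(2π)), every β ≥ 1.02, and every q ∈ ℝ with Φ(q) = 1 − α, one has q < β·√(−log(−(2πα²)·log(2πα²))). (Note that for such α one has 2πα² ∈ (0,1), so −(2πα²)log(2πα²) ∈ (0, 1/e] and the argument of the square root is at least 1.) -/
open Real MeasureTheory

/-- The cumulative distribution function of the standard Gaussian distribution. -/
noncomputable def Phi (x : ℝ) : ℝ :=
  (Real.sqrt (2 * Real.pi))⁻¹ * ∫ u in Set.Iic x, Real.exp (-u ^ 2 / 2)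

theorem hasDerivAt_gaussian_tail_majorant {u : ℝ} (hu : 0 < u) :
    HasDerivAt (fun u : ℝ => -(exp (-u ^ 2 / 2) * ((u ^ 2 + 2) / (u ^ 3 + 3 * u))))
      (exp (-u ^ 2 / 2) * (1 + 6 / (u ^ 2 * (u ^ 2 + 3) ^ 2))) u := by
  have h1 : HasDerivAt (fun u : ℝ => exp (-u ^ 2 / 2)) (exp (-u ^ 2 / 2) * -u) u := by
    have h : HasDerivAt (fun u : ℝ => -u ^ 2 / 2) (-u) u := by
      refine (((hasDerivAt_pow 2 u).fun_neg).div_const 2).congr_deriv ?_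
      norm_num
      ring
    exact h.exp
  have h2 : HasDerivAt (fun u : ℝ => (u ^ 2 + 2) / (u ^ 3 + 3 * u))
      ((2 * u * (u ^ 3 + 3 * u) - (u ^ 2 + 2) * (3 * u ^ 2 + 3)) / (u ^ 3 + 3 * u) ^ 2) u := by
    have hn : HasDerivAt (fun u : ℝ => u ^ 2 + 2) (2 * u) u := by
      simpa using (hasDerivAt_pow 2 u).add_const 2
    have hd : HasDerivAt (fun u : ℝ => u ^ 3 + 3 * u) (3 * u ^ 2 + 3) u := by
      simpa using (hasDerivAt_pow 3 u).fun_add ((hasDerivAt_id u).const_mul 3)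
    exact hn.fun_div hd (by positivity)
  refine (h1.fun_mul h2).fun_neg.congr_deriv ?_
  have h3 : u ^ 3 + 3 * u = u * (u ^ 2 + 3) := by ring
  rw [h3]
  field_simp
  ring

theorem integrable_exp_neg_sq_div_two : Integrable (fun u : ℝ => exp (-u ^ 2 / 2)) := by
  have := integrable_exp_neg_mul_sq (b := 1 / 2) (by norm_num)
  refine this.congr (Filter.Eventually.of_forall fun u => ?_)
  simp only
  congr 1
  ring

theorem integral_exp_neg_sq_div_two : ∫ u : ℝ, exp (-u ^ 2 / 2) = √(2 * π) := by
  have := integral_gaussian (1 / 2)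
  rw [show π / (1 / 2) = 2 * π by ring] at this
  rw [← this]
  congr 1
  ext u
  congr 1
  ring

/-- Upper bound for the Gaussian tail given by a convergent of its continued fraction. -/
theorem integral_Ioi_exp_neg_sq_div_two_le {q : ℝ} (hq : 0 < q) :
    ∫ u in Set.Ioi q, exp (-u ^ 2 / 2) ≤
      exp (-q ^ 2 / 2) * ((q ^ 2 + 2) / (q ^ 3 + 3 * q)) := by
  have hderiv : ∀ u ∈ Set.Ici q, HasDerivAt
      (fun u : ℝ => -(exp (-u ^ 2 / 2) * ((u ^ 2 + 2) / (u ^ 3 + 3 * u))))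
      (exp (-u ^ 2 / 2) * (1 + 6 / (u ^ 2 * (u ^ 2 + 3) ^ 2))) u :=
    fun u hu => hasDerivAt_gaussian_tail_majorant (hq.trans_le hu)
  have hlim : Filter.Tendsto
      (fun u : ℝ => -(exp (-u ^ 2 / 2) * ((u ^ 2 + 2) / (u ^ 3 + 3 * u))))
      Filter.atTop (nhds 0) := by
    have hinv : Filter.Tendsto (fun u : ℝ => -u⁻¹) Filter.atTop (nhds 0) := by
      simpa using tendsto_inv_atTop_zero.neg (α := ℝ)
    refine tendsto_of_tendsto_of_tendsto_of_le_of_le' hinv tendsto_const_nhds ?_ ?_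
    · filter_upwards [Filter.eventually_gt_atTop 0] with u hu
      have h1 : exp (-u ^ 2 / 2) ≤ 1 := exp_le_one_iff.2 (by nlinarith [sq_nonneg u])
      have h2 : (u ^ 2 + 2) / (u ^ 3 + 3 * u) ≤ u⁻¹ := by
        rw [inv_eq_one_div, div_le_div_iff₀ (by positivity) hu]
        nlinarith
      have h3 : 0 ≤ (u ^ 2 + 2) / (u ^ 3 + 3 * u) := by positivity
      nlinarith
    · filter_upwards [Filter.eventually_gt_atTop 0] with u hu
      have : 0 ≤ exp (-u ^ 2 / 2) * ((u ^ 2 + 2) / (u ^ 3 + 3 * u)) := by positivity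
      linarith
  have hnonneg : ∀ u ∈ Set.Ioi q,
      0 ≤ exp (-u ^ 2 / 2) * (1 + 6 / (u ^ 2 * (u ^ 2 + 3) ^ 2)) :=
    fun u _ => by positivity
  have hint := integrableOn_Ioi_deriv_of_nonneg' hderiv hnonneg hlim
  have heq := integral_Ioi_of_hasDerivAt_of_nonneg' hderiv hnonneg hlim
  calc ∫ u in Set.Ioi q, exp (-u ^ 2 / 2)
      ≤ ∫ u in Set.Ioi q, exp (-u ^ 2 / 2) * (1 + 6 / (u ^ 2 * (u ^ 2 + 3) ^ 2)) := by
        refine setIntegral_mono_on integrable_exp_neg_sq_div_two.integrableOn hint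
          measurableSet_Ioi fun u _ => ?_
        refine le_mul_of_one_le_right (exp_pos _).le ?_
        have : 0 ≤ 6 / (u ^ 2 * (u ^ 2 + 3) ^ 2) := by positivity
        linarith
    _ = _ := by rw [heq]; ring

theorem one_sub_Phi (q : ℝ) :
    √(2 * π) * (1 - Phi q) = ∫ u in Set.Ioi q, exp (-u ^ 2 / 2) := by
  have hs : √(2 * π) ≠ 0 := by positivity
  have h := intervalIntegral.integral_Iic_add_Ioi (b := q) (μ := volume)
    integrable_exp_neg_sq_div_two.integrableOn integrable_exp_neg_sq_div_two.integrableOn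
  rw [integral_exp_neg_sq_div_two] at h
  rw [Phi, mul_sub, mul_inv_cancel_left₀ hs]
  linarith

theorem sub_log_le_sub_log {a b : ℝ} (ha : 1 ≤ a) (hab : a ≤ b) :
    a - log a ≤ b - log b := by
  have ha0 : 0 < a := by linarith
  have h := log_le_sub_one_of_pos (div_pos (ha0.trans_le hab) ha0)
  rw [log_div (by linarith) (by linarith)] at h
  have : b / a - 1 ≤ b - a := by
    rw [div_sub_one ha0.ne', div_le_iff₀ ha0]
    nlinarith
  linarith

theorem lt_mul_sub_log {x : ℝ} (hx : 1.0404 ≤ x) :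
    x < 1.0404 * ((x + log x + 2 * log ((x + 3) / (x + 2))) -
      log (x + log x + 2 * log ((x + 3) / (x + 2)))) := by
  have hx0 : 0 < x := by linarith
  have hlogx : 0 ≤ log x := log_nonneg (by linarith)
  have hr : 1 ≤ (x + 3) / (x + 2) := by rw [le_div_iff₀ (by linarith)]; linarith
  have hl0 := log_nonneg hr
  have hlog : log x ≤ x / 2 - 0.30685 := by
    have h := log_le_sub_one_of_pos (show 0 < x / 2 by linarith)
    rw [log_div hx0.ne' (by norm_num)] at h
    linarith [log_two_lt_d9]
  have hl1 : log ((x + 3) / (x + 2)) ≤ 1 / (x + 2) := by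
    have h := log_le_sub_one_of_pos (show 0 < (x + 3) / (x + 2) by positivity)
    have : (x + 3) / (x + 2) - 1 = 1 / (x + 2) := by field_simp; ring
    linarith
  set k : ℝ := 0.0388 with hk
  have hexp : 1 + k * x + (k * x) ^ 2 / 2 ≤ exp (k * x) :=
    quadratic_le_exp_of_nonneg (by positivity)
  have hpoly : x + (x / 2 - 0.30685) + 2 * (1 / (x + 2)) <
      x * ((x + 3) / (x + 2)) ^ 2 * (1 + k * x + (k * x) ^ 2 / 2) := by
    rw [← sub_pos]
    have : x * ((x + 3) / (x + 2)) ^ 2 * (1 + k * x + (k * x) ^ 2 / 2) -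
        (x + (x / 2 - 0.30685) + 2 * (1 / (x + 2))) =
        (x * (x + 3) ^ 2 * (1 + k * x + (k * x) ^ 2 / 2) -
          (x + (x / 2 - 0.30685)) * (x + 2) ^ 2 - 2 * (x + 2)) / (x + 2) ^ 2 := by
      field_simp
      ring
    rw [this]
    refine div_pos ?_ (by positivity)
    obtain ⟨t, ht, rfl⟩ : ∃ t : ℝ, 0 ≤ t ∧ x = 1.0404 + t := ⟨x - 1.0404, by linarith, by ring⟩
    rw [hk]
    ring_nf
    nlinarith [pow_nonneg ht 3, pow_nonneg ht 4, pow_nonneg ht 5, sq_nonneg (t - 1),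
      mul_nonneg ht (sq_nonneg (t - 1)), mul_nonneg ht (sq_nonneg (t - 2))]
  have hlt : x + log x + 2 * log ((x + 3) / (x + 2)) <
      x * ((x + 3) / (x + 2)) ^ 2 * exp (k * x) :=
    calc _ ≤ x + (x / 2 - 0.30685) + 2 * (1 / (x + 2)) := by linarith
      _ < _ := hpoly
      _ ≤ _ := by gcongr
  have h := log_lt_log (by linarith) hlt
  rw [log_mul (by positivity) (exp_pos _).ne', log_mul hx0.ne' (by positivity), log_pow,
    log_exp] at h
  push_cast at h
  rw [hk] at h
  linarith

theorem inverse_gaussian_cdf_upper_bound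
    (α β q : ℝ) (hα : α ∈ Set.Ioo 0 (1 / Real.sqrt (2 * Real.pi)))
    (hβ : 1.02 ≤ β) (hq : Phi q = 1 - α) :
    q < β * Real.sqrt (-Real.log (-(2 * Real.pi * α ^ 2) *
      Real.log (2 * Real.pi * α ^ 2))) := by
  obtain ⟨hα0, hα1⟩ := hα
  have hs : 0 < √(2 * π) := by positivity
  obtain ⟨m, hm⟩ : ∃ m, m = √(2 * π) * α := ⟨_, rfl⟩
  have hm0 : 0 < m := by rw [hm]; positivity
  have hm1 : m < 1 := by
    rw [lt_div_iff₀ hs] at hα1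
    linarith
  have hmsq : 2 * π * α ^ 2 = m ^ 2 := by
    rw [hm, mul_pow, sq_sqrt (by positivity)]
  have htail : ∫ u in Set.Ioi q, exp (-u ^ 2 / 2) = m := by
    rw [← one_sub_Phi, hq, hm]; ring
  have hlogm := log_neg hm0 hm1
  obtain ⟨y, hy⟩ : ∃ y, y = -(2 * log m) := ⟨_, rfl⟩
  have hy0 : 0 < y := by linarith
  have hW : -log (-(2 * π * α ^ 2) * log (2 * π * α ^ 2)) = y - log y := by
    rw [hmsq, log_pow, show -m ^ 2 * (((2 : ℕ) : ℝ) * log m) = m ^ 2 * y by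
      rw [hy]; push_cast; ring, log_mul (by positivity) hy0.ne', log_pow, hy]
    push_cast
    ring
  rw [hW]
  have hW1 : 1 ≤ y - log y := by linarith [log_le_sub_one_of_pos hy0]
  by_contra! hcon
  have hsqrt : 1 ≤ √(y - log y) := one_le_sqrt.2 hW1
  have hq1 : 1.02 * √(y - log y) ≤ q := by nlinarith
  have hq0 : 0 < q := by linarith
  have hqsq : 1.0404 * (y - log y) ≤ q ^ 2 := by
    have h := sq_sqrt (show 0 ≤ y - log y by linarith)
    nlinarith
  have hx : 1.0404 ≤ q ^ 2 := by linarith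
  have hle := integral_Ioi_exp_neg_sq_div_two_le hq0
  rw [htail] at hle
  have hlog := log_le_log hm0 hle
  have hr : (q ^ 2 + 2) / (q ^ 3 + 3 * q) = ((q ^ 2 + 3) / (q ^ 2 + 2))⁻¹ * q⁻¹ := by
    have : q ^ 3 + 3 * q = q * (q ^ 2 + 3) := by ring
    rw [this]
    field_simp
  rw [hr, log_mul (exp_pos _).ne' (by positivity), log_mul (by positivity) (by positivity),
    log_inv, log_inv, log_exp] at hlog
  have hlogsq : log (q ^ 2) = 2 * log q := by rw [log_pow]; norm_num
  have hY : q ^ 2 + log (q ^ 2) + 2 * log ((q ^ 2 + 3) / (q ^ 2 + 2)) ≤ y := by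
    rw [hlogsq, hy]
    linarith
  have hY1 : 1 ≤ q ^ 2 + log (q ^ 2) + 2 * log ((q ^ 2 + 3) / (q ^ 2 + 2)) := by
    have h1 : 0 ≤ log (q ^ 2) := log_nonneg (by linarith)
    have h2 : 0 ≤ log ((q ^ 2 + 3) / (q ^ 2 + 2)) :=
      log_nonneg (by rw [le_div_iff₀ (by positivity)]; linarith)
    linarith
  have hmono := sub_log_le_sub_log hY1 hY
  have := lt_mul_sub_log hx
  linarith
end

section
/- Fix β = 1.02. The function h : (0,1) → ℝ defined by h(x) = Φ(β·√(−log(−x·log x))) + √x/√(2π) − 1 is monotonically nondecreasing on (0,1). (For x ∈ (0,1) one has −x·log x ∈ (0, 1/e], so −log(−x·log x) ≥ 1 > 0 and h is well defined.) -/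
open Real MeasureTheory

/-- The auxiliary function `h` from the proof of the inverse Gaussian tail bound,
with `β = 1.02`. -/
noncomputable def hFun (x : ℝ) : ℝ :=
  Phi (1.02 * Real.sqrt (-Real.log (-x * Real.log x))) +
    Real.sqrt x / Real.sqrt (2 * Real.pi) - 1

theorem Phi_hasDerivAt (x : ℝ) :
    HasDerivAt Phi ((Real.sqrt (2 * Real.pi))⁻¹ * Real.exp (-x ^ 2 / 2)) x := by
  have hcont : Continuous fun u : ℝ => Real.exp (-u ^ 2 / 2) := by fun_prop
  have hint : Integrable fun u : ℝ => Real.exp (-u ^ 2 / 2) := by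
    have h := integrable_exp_neg_mul_sq (b := 1 / 2) (by norm_num)
    refine h.congr (Filter.Eventually.of_forall fun u => ?_)
    simp only
    congr 1
    ring
  have hsplit : Phi = fun y => (Real.sqrt (2 * Real.pi))⁻¹ *
      ((∫ u in Set.Iic (0 : ℝ), Real.exp (-u ^ 2 / 2)) +
        ∫ u in (0 : ℝ)..y, Real.exp (-u ^ 2 / 2)) := by
    funext y
    have h := intervalIntegral.integral_Iic_sub_Iic (a := 0) (b := y)
      hint.integrableOn hint.integrableOn
    rw [← h, Phi]
    ring
  rw [hsplit]
  exact ((hcont.integral_hasStrictDerivAt 0 x).hasDerivAt.const_add _).const_mul _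

theorem mul_sq_sub_one_mul_exp_le {L : ℝ} (hL : 1 ≤ L) :
    1.0404 * (L - 1) ^ 2 * Real.exp (-(0.0404 * (L - Real.log L))) ≤ L * (L - Real.log L) := by
  have hlog : Real.log L ≤ L / 4 + 0.387 := by
    have h1 := Real.log_le_sub_one_of_pos (show 0 < L / 4 by linarith)
    rw [Real.log_div (by linarith) (by norm_num), show (4 : ℝ) = 2 ^ 2 by norm_num,
      Real.log_pow] at h1
    have h2 := Real.log_two_lt_d9
    push_cast at h1
    linarith
  set s := L - Real.log L with hs
  have hsl : 3 / 4 * L - 0.387 ≤ s := by linarith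
  have hs0 : 0 < s := by linarith
  have hexp : Real.exp (-(0.0404 * s)) * (1 + 0.0404 * s) ≤ 1 := by
    have h1 := Real.add_one_le_exp (0.0404 * s)
    calc Real.exp (-(0.0404 * s)) * (1 + 0.0404 * s)
        ≤ Real.exp (-(0.0404 * s)) * Real.exp (0.0404 * s) := by gcongr; linarith
      _ = 1 := by rw [← Real.exp_add]; simp
  have hpoly : 1.0404 * (L - 1) ^ 2 ≤ L * s * (1 + 0.0404 * s) := by
    have h1 : L * (3 / 4 * L - 0.387) * (1 + 0.0404 * (3 / 4 * L - 0.387)) ≤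
        L * s * (1 + 0.0404 * s) := by
      have : 0 ≤ 3 / 4 * L - 0.387 := by linarith
      gcongr
    have h2 : 1.0404 * (L - 1) ^ 2 ≤
        L * (3 / 4 * L - 0.387) * (1 + 0.0404 * (3 / 4 * L - 0.387)) := by
      nlinarith [mul_nonneg (show 0 ≤ L by linarith) (sq_nonneg (L - 8)),
        sq_nonneg (L - 4), sq_nonneg (L - 2)]
    linarith
  calc 1.0404 * (L - 1) ^ 2 * Real.exp (-(0.0404 * s))
      ≤ L * s * (1 + 0.0404 * s) * Real.exp (-(0.0404 * s)) := by gcongr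
    _ = L * s * (Real.exp (-(0.0404 * s)) * (1 + 0.0404 * s)) := by ring
    _ ≤ L * s * 1 := by gcongr
    _ = L * s := mul_one _

theorem hFun_hasDerivAt_nonneg {x : ℝ} (hx : x ∈ Set.Ioo (0 : ℝ) 1) :
    ∃ d, HasDerivAt hFun d x ∧ 0 ≤ d := by
  obtain ⟨hx0, hx1⟩ := hx
  obtain ⟨L, hLdef⟩ : ∃ L, L = -Real.log x := ⟨_, rfl⟩
  have hlogx : Real.log x = -L := by linarith
  have hL : 0 < L := by have := Real.log_neg hx0 hx1; linarith
  have hw : -x * Real.log x = x * L := by rw [hlogx]; ring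
  have hw0 : 0 < x * L := mul_pos hx0 hL
  obtain ⟨s, hsdef⟩ : ∃ s, s = L - Real.log L := ⟨_, rfl⟩
  have hlogw : -Real.log (-x * Real.log x) = s := by
    rw [hw, Real.log_mul hx0.ne' hL.ne', hlogx, hsdef]; ring
  have hs : 0 < s := by have := Real.log_le_sub_one_of_pos hL; linarith
  have d1 : HasDerivAt (fun y => -y * Real.log y) (L - 1) x := by
    convert! (hasDerivAt_id x).neg.mul (Real.hasDerivAt_log hx0.ne') using 1
    rw [hlogx]
    simp
    field_simp
    ring
  have d2 := ((d1.log (by rw [hw]; exact hw0.ne')).neg.sqrt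
    (by simp only [Pi.neg_apply]; rw [hlogw]; exact hs.ne')).const_mul (1.02 : ℝ)
  have d3 := (((Phi_hasDerivAt _).comp x d2).add
    ((Real.hasDerivAt_sqrt hx0.ne').div_const (Real.sqrt (2 * Real.pi)))).sub_const 1
  refine ⟨_, d3, ?_⟩
  simp only [Pi.neg_apply]
  rw [hlogw, hw]
  have hsq : (1.02 * √s) ^ 2 = 1.0404 * s := by rw [mul_pow, Real.sq_sqrt hs.le]; norm_num
  rw [hsq]
  have hexps : Real.exp (-s) = x * L := by
    rw [← hlogw, neg_neg, hw, Real.exp_log hw0]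
  have key : 1.02 * (L - 1) * Real.exp (-(1.0404 * s) / 2) * √x ≤ x * L * √s := by
    rcases le_total L 1 with h | h
    · refine le_trans ?_ (by positivity : 0 ≤ x * L * √s)
      have : 0 ≤ 1.02 * (1 - L) * Real.exp (-(1.0404 * s) / 2) * √x := by
        have : 0 ≤ 1 - L := by linarith
        positivity
      linarith
    · refine (abs_le_of_sq_le_sq' ?_ (by positivity)).2
      have hmain := mul_sq_sub_one_mul_exp_le h
      rw [← hsdef] at hmain
      have he : Real.exp (-(1.0404 * s) / 2) ^ 2 = x * L * Real.exp (-(0.0404 * s)) := by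
        rw [← hexps, ← Real.exp_add, ← Real.exp_nat_mul]
        congr 1; push_cast; ring
      calc (1.02 * (L - 1) * Real.exp (-(1.0404 * s) / 2) * √x) ^ 2
          = 1.0404 * (L - 1) ^ 2 * Real.exp (-(1.0404 * s) / 2) ^ 2 * √x ^ 2 := by ring
        _ = x ^ 2 * L * (1.0404 * (L - 1) ^ 2 * Real.exp (-(0.0404 * s))) := by
          rw [he, Real.sq_sqrt hx0.le]; ring
        _ ≤ x ^ 2 * L * (L * s) := by gcongr
        _ = (x * L * √s) ^ 2 := by rw [mul_pow, Real.sq_sqrt hs.le]; ring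
  have hsx : 0 < √x := Real.sqrt_pos.2 hx0
  have hss : 0 < √s := Real.sqrt_pos.2 hs
  have hpi : 0 < √(2 * Real.pi) := Real.sqrt_pos.2 (by positivity)
  have heq : (√(2 * Real.pi))⁻¹ * Real.exp (-(1.0404 * s) / 2) *
        (1.02 * (-((L - 1) / (x * L)) / (2 * √s))) + 1 / (2 * √x) / √(2 * Real.pi) =
      (x * L * √s - 1.02 * (L - 1) * Real.exp (-(1.0404 * s) / 2) * √x) /
        (2 * √(2 * Real.pi) * (x * L) * √s * √x) := by
    field_simp
    ring
  rw [heq]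
  exact div_nonneg (by linarith) (by positivity)

theorem hFun_monotoneOn : MonotoneOn hFun (Set.Ioo (0 : ℝ) 1) := by
  refine monotoneOn_of_deriv_nonneg (convex_Ioo 0 1) ?_ ?_ ?_
  · intro x hx
    obtain ⟨d, hd, -⟩ := hFun_hasDerivAt_nonneg hx
    exact hd.continuousAt.continuousWithinAt
  · intro x hx
    obtain ⟨d, hd, -⟩ := hFun_hasDerivAt_nonneg (interior_subset hx)
    exact hd.differentiableAt.differentiableWithinAt
  · intro x hx
    obtain ⟨d, hd, h0⟩ := hFun_hasDerivAt_nonneg (interior_subset hx)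
    rwa [hd.deriv]
end

section
/- Fix β = 1.02. For every x ∈ (0,1), one has 1/√x + β·(−x·log x)^{β²/2 − 1}·(1 + log x)/√(−log(−x·log x)) ≥ 0. (For x ∈ (0,1) one has −x·log x ∈ (0, 1/e], so −log(−x·log x) ≥ 1 > 0 and the expression is well defined.) -/
open Real

lemma three_quarters_mul_sub_le_sub_log {t : ℝ} (ht : 0 < t) :
    0.75 * t - 0.3864 ≤ t - log t := by
  have h := log_le_sub_one_of_pos (show 0 < t / 4 by positivity)
  have h4 : log 4 = 2 * log 2 := by
    rw [show (4 : ℝ) = 2 ^ 2 by norm_num, log_pow]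
    norm_num
  rw [log_div ht.ne' (by norm_num), h4] at h
  linarith [log_two_lt_d9]

lemma sq_sub_one_le_mul_exp {t : ℝ} (ht : 1 ≤ t) :
    (1.02 * (t - 1)) ^ 2 ≤ t * (t - log t) * exp (0.0404 * (t - log t)) := by
  have hs := three_quarters_mul_sub_le_sub_log (zero_lt_one.trans_le ht)
  set s := t - log t
  have hL : 0 ≤ 0.75 * t - 0.3864 := by linarith
  have hs0 : 0 ≤ s := hL.trans hs
  have hexp : 1 + 0.0404 * (0.75 * t - 0.3864) ≤ exp (0.0404 * s) := by
    linarith [add_one_le_exp (0.0404 * s)]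
  calc (1.02 * (t - 1)) ^ 2
      ≤ t * (0.75 * t - 0.3864) * (1 + 0.0404 * (0.75 * t - 0.3864)) := by
        nlinarith [mul_nonneg (sub_nonneg.2 ht) (sq_nonneg (t - 8)), sq_nonneg (t - 8),
          mul_nonneg (sub_nonneg.2 ht) (sq_nonneg (t - 9)), sq_nonneg (t - 9)]
    _ ≤ t * s * exp (0.0404 * s) := by gcongr

lemma mul_exp_mul_sub_one_le {t : ℝ} (ht : 1 ≤ t) :
    1.02 * exp (0.4798 * (t - log t)) * (t - 1) ≤ exp (t / 2) * √(t - log t) := by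
  have ht0 : 0 < t := zero_lt_one.trans_le ht
  have hs : 0 ≤ t - log t := by linarith [three_quarters_mul_sub_le_sub_log ht0]
  refine (abs_le_of_sq_le_sq' ?_ (by positivity)).2
  have hexp : exp (t / 2) ^ 2 =
      exp (0.4798 * (t - log t)) ^ 2 * (t * exp (0.0404 * (t - log t))) := by
    nth_rewrite 4 [← exp_log ht0]
    simp only [← exp_nat_mul, ← exp_add]
    congr 1
    push_cast
    ring
  rw [mul_pow (exp (t / 2)), sq_sqrt hs, hexp]
  have h := mul_le_mul_of_nonneg_left (sq_sub_one_le_mul_exp ht)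
    (sq_nonneg (exp (0.4798 * (t - log t))))
  linarith

theorem g_nonneg (x : ℝ) (hx : x ∈ Set.Ioo (0 : ℝ) 1) :
    0 ≤ 1 / Real.sqrt x +
      1.02 * (-x * Real.log x) ^ ((1.02 : ℝ) ^ 2 / 2 - 1) * (1 + Real.log x) /
        Real.sqrt (-Real.log (-x * Real.log x)) := by
  obtain ⟨hx0, hx1⟩ := hx
  obtain ⟨t, rfl⟩ : ∃ t, x = exp (-t) := ⟨-log x, by rw [neg_neg, exp_log hx0]⟩
  have ht : 0 < t := by simpa using hx1
  have hy : -exp (-t) * log (exp (-t)) = exp (-(t - log t)) := by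
    rw [log_exp, neg_sub, sub_eq_add_neg, exp_add, exp_log ht]
    ring
  have hsqrt : 1 / √(exp (-t)) = exp (t / 2) := by
    rw [← exp_half, one_div, ← exp_neg]
    congr 1
    ring
  rw [hy, hsqrt, log_exp, log_exp, neg_neg, ← exp_mul,
    show -(t - log t) * ((1.02 : ℝ) ^ 2 / 2 - 1) = 0.4798 * (t - log t) by ring]
  rcases le_total t 1 with h1 | h1
  · have : 0 ≤ 1 + -t := by linarith
    positivity
  · have hs : 0 < t - log t := by linarith [three_quarters_mul_sub_le_sub_log ht]
    have hr := sqrt_pos.2 hs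
    have h := mul_exp_mul_sub_one_le h1
    rw [← div_le_iff₀ hr] at h
    have e : 1.02 * exp (0.4798 * (t - log t)) * (1 + -t) / √(t - log t) =
        -(1.02 * exp (0.4798 * (t - log t)) * (t - 1) / √(t - log t)) := by ring
    linarith
end

section
/- Fix β = 1.02. For every real t ≥ 1, one has t − log t ≥ β² · t^{β² − 2} · (1 − 2t + t²) · e^{−(β² − 1)t}. -/
open Real

theorem le_sub_log_of_one_le {t : ℝ} (ht : 1 ≤ t) : 0.75 * t - 0.3864 ≤ t - Real.log t := by
  have hdiv := Real.log_le_sub_one_of_pos (show 0 < t / 4 by linarith)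
  rw [Real.log_div (by linarith) (by norm_num), show (4 : ℝ) = 2 ^ 2 by norm_num,
    Real.log_pow] at hdiv
  push_cast at hdiv
  linarith [Real.log_two_lt_d9]

theorem cubic_bound {t : ℝ} (ht : 1 ≤ t) :
    1.0404 * (t - 1) ^ 2 ≤
      t * ((0.75 * t - 0.3864) * (1 + 0.0404 * (0.75 * t - 0.3864))) := by
  nlinarith [mul_nonneg (sub_nonneg.2 ht) (sq_nonneg (t - 7)),
    mul_nonneg (sub_nonneg.2 ht) (sq_nonneg (t - 8)), sq_nonneg (t - 7), sq_nonneg (t - 1)]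

theorem t_sub_log_ge (t : ℝ) (ht : 1 ≤ t) :
    t - Real.log t ≥
      (1.02 : ℝ) ^ 2 * t ^ ((1.02 : ℝ) ^ 2 - 2) * (1 - 2 * t + t ^ 2) *
        Real.exp (-((1.02 : ℝ) ^ 2 - 1) * t) := by
  have hpos : 0 < t := by linarith
  have hlog := le_sub_log_of_one_le ht
  set u := t - Real.log t with hu
  have hpow : t ^ ((1.02 : ℝ) ^ 2 - 2) * Real.exp (-((1.02 : ℝ) ^ 2 - 1) * t) =
      (t * Real.exp (0.0404 * u))⁻¹ := by
    rw [mul_inv, ← Real.exp_neg, Real.rpow_def_of_pos hpos, ← Real.exp_add]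
    nth_rewrite 3 [← Real.exp_log hpos]
    rw [← Real.exp_neg, ← Real.exp_add, hu]
    congr 1
    ring
  have hexp : 1 + 0.0404 * u ≤ Real.exp (0.0404 * u) := by
    linarith [Real.add_one_le_exp (0.0404 * u)]
  have hbound : 1.0404 * (t - 1) ^ 2 ≤ u * (t * Real.exp (0.0404 * u)) :=
    calc 1.0404 * (t - 1) ^ 2
        ≤ t * ((0.75 * t - 0.3864) * (1 + 0.0404 * (0.75 * t - 0.3864))) := cubic_bound ht
      _ ≤ t * (u * Real.exp (0.0404 * u)) := by
          refine mul_le_mul_of_nonneg_left ?_ hpos.le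
          exact mul_le_mul hlog (by linarith) (by linarith) (by linarith)
      _ = u * (t * Real.exp (0.0404 * u)) := by ring
  calc (1.02 : ℝ) ^ 2 * t ^ ((1.02 : ℝ) ^ 2 - 2) * (1 - 2 * t + t ^ 2) *
        Real.exp (-((1.02 : ℝ) ^ 2 - 1) * t)
      = 1.0404 * (t - 1) ^ 2 *
          (t ^ ((1.02 : ℝ) ^ 2 - 2) * Real.exp (-((1.02 : ℝ) ^ 2 - 1) * t)) := by ring
    _ = 1.0404 * (t - 1) ^ 2 / (t * Real.exp (0.0404 * u)) := by rw [hpow, div_eq_mul_inv]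
    _ ≤ u := (div_le_iff₀ (by positivity)).2 hbound
end

section
/- Fix β = 1.02. For every real t ≥ 1, one has β² · t^{β² − 3} · (1 − 2t + t²) · e^{−(β² − 1)t} − 1 ≤ −1/e; moreover, the function t ↦ β² · t^{β² − 3} · (1 − 2t + t²) · e^{−(β² − 1)t} attains its maximum over [1, +∞) at t* = 1 + √(2/(β² − 1)). -/
open Real

/-- The function maximized in the proof of the inverse Gaussian tail bound,
with `β = 1.02`. -/
noncomputable def fFun (t : ℝ) : ℝ :=
  (1.02 : ℝ) ^ 2 * t ^ ((1.02 : ℝ) ^ 2 - 3) * (1 - 2 * t + t ^ 2) *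
    Real.exp (-((1.02 : ℝ) ^ 2 - 1) * t)

/-- The logarithm of `fFun t / 1.02 ^ 2` for `1 < t`. -/
noncomputable def fFunLog (t : ℝ) : ℝ :=
  2 * log (t - 1) + (0.0404 - 2) * log t - 0.0404 * t

lemma fFun_eq_exp_fFunLog {t : ℝ} (ht : 1 < t) : fFun t = 1.0404 * exp (fFunLog t) := by
  have h₀ : 0 < t := by linarith
  have h₁ : 0 < t - 1 := by linarith
  have hsq : 1 - 2 * t + t ^ 2 = exp (2 * log (t - 1)) := by
    rw [two_mul (log _), exp_add, exp_log h₁]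
    ring
  rw [fFun, fFunLog, hsq, rpow_def_of_pos h₀, mul_assoc, mul_assoc, ← exp_add, ← exp_add]
  norm_num
  ring_nf

lemma fFun_one : fFun 1 = 0 := by
  norm_num [fFun]

lemma fFunLog_sub_le {s t : ℝ} (hs : 1 < s) (ht : 1 < t) :
    fFunLog t - fFunLog s ≤ (t - s) * (2 / (t * (s - 1)) - 0.0404 * (s - 1) / s) := by
  have hs₀ : 0 < s := by linarith
  have hs₁ : 0 < s - 1 := by linarith
  have ht₀ : 0 < t := by linarith
  have ht₁ : 0 < t - 1 := by linarith
  have h₁ := log_le_sub_one_of_pos (div_pos ht₀ hs₀)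
  have h₂ := log_le_sub_one_of_pos (div_pos (mul_pos ht₁ hs₀) (mul_pos ht₀ hs₁))
  rw [log_div ht₀.ne' hs₀.ne'] at h₁
  rw [log_div (mul_pos ht₁ hs₀).ne' (mul_pos ht₀ hs₁).ne', log_mul ht₁.ne' hs₀.ne',
    log_mul ht₀.ne' hs₁.ne'] at h₂
  have key : (t - s) * (2 / (t * (s - 1)) - 0.0404 * (s - 1) / s) =
      2 * ((t - 1) * s / (t * (s - 1)) - 1) + 0.0404 * (t / s - 1) - 0.0404 * (t - s) := by
    field_simp
    ring
  rw [key, fFunLog, fFunLog]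
  linarith

lemma fFunLog_le_of_critical {s t : ℝ} (hs : 1 < s) (hcrit : 0.0404 * (s - 1) ^ 2 = 2)
    (ht : 1 < t) : fFunLog t ≤ fFunLog s := by
  have hs₁ : 0 < s - 1 := by linarith
  have hs₀ : 0 < s := by linarith
  have ht₀ : 0 < t := by linarith
  have key : (t - s) * (2 / (t * (s - 1)) - 0.0404 * (s - 1) / s) =
      -(2 * (t - s) ^ 2 / (t * s * (s - 1))) := by
    have h : 0.0404 * (s - 1) / s = 2 / (s * (s - 1)) := by
      rw [← hcrit]
      field_simp
    rw [h]
    field_simp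
    ring
  have hnonneg : 0 ≤ 2 * (t - s) ^ 2 / (t * s * (s - 1)) := by positivity
  have := fFunLog_sub_le hs ht
  linarith

lemma fFunLog_le {t : ℝ} (ht : 1 < t) : fFunLog t ≤ fFunLog 8 + 0.001 := by
  have ht₀ : 0 < t := by linarith
  have h := fFunLog_sub_le (s := 8) (by norm_num) ht
  have hbound : (t - 8) * (2 / (t * (8 - 1)) - 0.0404 * (8 - 1) / 8) ≤ 0.001 := by
    have key : (t - 8) * (2 / (t * (8 - 1)) - 0.0404 * (8 - 1) / 8) =
        (t - 8) * (2 / 7 - 0.03535 * t) / t := by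
      field_simp
      ring
    rw [key, div_le_iff₀ ht₀]
    nlinarith [sq_nonneg (t - 8.036)]
  linarith

lemma exp_fFunLog_eight_le : 1.0404 * exp (fFunLog 8 + 0.001) ≤ 0.632 := by
  have hlog : log (8 : ℝ) = 3 * log 2 := by
    rw [show (8 : ℝ) = 2 ^ 3 by norm_num, log_pow]
    norm_num
  have heq : fFunLog 8 + 0.001 = 2 * log (7 / 8) + (0.1212 * log 2 - 0.3222) := by
    rw [fFunLog, log_div (by norm_num) (by norm_num), hlog]
    norm_num
    ring
  have hle : fFunLog 8 + 0.001 ≤ 2 * log (7 / 8) + -0.238 := by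
    have := log_two_lt_d9
    rw [heq]
    linarith
  have hquad := quadratic_le_exp_of_nonneg (x := 0.238) (by norm_num)
  have hneg : exp (-0.238) ≤ 1 / 1.266 := by
    rw [exp_neg, ← one_div]
    exact one_div_le_one_div_of_le (by norm_num) (by linarith)
  calc 1.0404 * exp (fFunLog 8 + 0.001)
      ≤ 1.0404 * exp (2 * log (7 / 8) + -0.238) := by gcongr
    _ = 1.0404 * (49 / 64) * exp (-0.238) := by
        rw [exp_add, two_mul, exp_add, exp_log (by norm_num)]
        ring
    _ ≤ 1.0404 * (49 / 64) * (1 / 1.266) := by gcongr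
    _ ≤ 0.632 := by norm_num

theorem fFun_le_and_max :
    (∀ t : ℝ, 1 ≤ t → fFun t - 1 ≤ -(1 / Real.exp 1)) ∧
      (1 + Real.sqrt (2 / ((1.02 : ℝ) ^ 2 - 1)) ∈ Set.Ici (1 : ℝ)) ∧
      (∀ t : ℝ, 1 ≤ t →
        fFun t ≤ fFun (1 + Real.sqrt (2 / ((1.02 : ℝ) ^ 2 - 1)))) := by
  refine ⟨fun t ht => ?_, ?_, fun t ht => ?_⟩
  · have he : 1 / exp 1 ≤ 0.368 := by
      rw [div_le_iff₀ (exp_pos 1)]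
      linarith [exp_one_gt_d9]
    have hf : fFun t ≤ 0.632 := by
      rcases ht.eq_or_lt with rfl | ht
      · rw [fFun_one]
        norm_num
      · rw [fFun_eq_exp_fFunLog ht]
        refine le_trans ?_ exp_fFunLog_eight_le
        gcongr
        exact fFunLog_le ht
    linarith
  · exact le_add_of_nonneg_right (sqrt_nonneg _)
  · have hs : 1 < 1 + √(2 / ((1.02 : ℝ) ^ 2 - 1)) :=
      lt_add_of_pos_right _ (sqrt_pos.2 (by norm_num))
    have hcrit : 0.0404 * (1 + √(2 / ((1.02 : ℝ) ^ 2 - 1)) - 1) ^ 2 = 2 := by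
      rw [add_sub_cancel_left, sq_sqrt (by norm_num)]
      norm_num
    rw [fFun_eq_exp_fFunLog hs]
    rcases ht.eq_or_lt with rfl | ht
    · rw [fFun_one]
      positivity
    · rw [fFun_eq_exp_fFunLog ht]
      gcongr
      exact fFunLog_le_of_critical hs hcrit ht
end

section
/- Let N ≥ 1, let σ_s > 0 be real, let Σ₀ be a symmetric positive semidefinite real N×N matrix, and let Σ₀d be the diagonal N×N matrix whose diagonal entries agree with those of Σ₀. Given any horizon T and any sequence of indices i₁, …, i_T in {1, …, N}, define recursively Σ_t = Σ_{t−1} − (Σ_{t−1} e_{i_t} e_{i_t}ᵀ Σ_{t−1})/(σ_s² + (Σ_{t−1})_{i_t i_t}) for t = 1, …, T, and define Σ_{td} by the same recursion started from Σ_{0d} = Σ₀d (with the same index sequence). Then for every t ∈ {0, 1, …, T} and every i ∈ {1, …, N}, (Σ_t)_{ii} ≤ (Σ_{td})_{ii}. -/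
open Matrix

/-- The rank-one posterior covariance update with observation noise variance `σs ^ 2`
for an observation of coordinate `q`. -/
noncomputable def covUpdate {n : ℕ} (σs : ℝ) (q : Fin n)
    (S : Matrix (Fin n) (Fin n) ℝ) : Matrix (Fin n) (Fin n) ℝ :=
  S - (σs ^ 2 + S q q)⁻¹ • Matrix.of (fun j k => S j q * S q k)

theorem covUpdate_apply {n : ℕ} (σs : ℝ) (q : Fin n) (S : Matrix (Fin n) (Fin n) ℝ)
    (i j : Fin n) :
    covUpdate σs q S i j = S i j - (σs ^ 2 + S q q)⁻¹ * (S i q * S q j) := by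
  simp [covUpdate]

/-- The covariance update in Joseph form. -/
theorem covUpdate_eq_joseph {n : ℕ} {σs : ℝ} {q : Fin n} {S : Matrix (Fin n) (Fin n) ℝ}
    (hS : Sᵀ = S) (hq : σs ^ 2 + S q q ≠ 0) :
    let K : Fin n → ℝ := fun j => (σs ^ 2 + S q q)⁻¹ * S j q
    covUpdate σs q S =
      (1 - vecMulVec K (Pi.single q 1)) * S * (1 - vecMulVec K (Pi.single q 1))ᵀ +
        σs ^ 2 • vecMulVec K K := by
  intro K
  have hsymm (a b : Fin n) : S a b = S b a := congrFun (congrFun hS b) a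
  ext i j
  rw [covUpdate_apply]
  simp only [transpose_sub, transpose_one, transpose_vecMulVec, sub_mul, mul_sub, one_mul, mul_one,
    vecMulVec_mul, mul_vecMulVec, single_one_vecMul, mulVec_single_one,
    Matrix.sub_apply, Matrix.add_apply,
    Matrix.smul_apply, vecMulVec_apply, smul_eq_mul, row_apply, col_apply, K]
  rw [hsymm j q]
  field_simp
  ring

theorem posSemidef_covUpdate {n : ℕ} {σs : ℝ} (hσ : 0 < σs) (q : Fin n)
    {S : Matrix (Fin n) (Fin n) ℝ} (hS : S.PosSemidef) : (covUpdate σs q S).PosSemidef := by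
  have hq : 0 < σs ^ 2 + S q q := add_pos_of_pos_of_nonneg (pow_pos hσ 2) hS.diag_nonneg
  have hT : Sᵀ = S := by simpa [IsHermitian, conjTranspose_eq_transpose_of_trivial] using hS.1
  rw [covUpdate_eq_joseph hT hq.ne']
  refine PosSemidef.add ?_ (PosSemidef.smul ?_ (sq_nonneg σs))
  · simpa only [conjTranspose_eq_transpose_of_trivial] using
      hS.mul_mul_conjTranspose_same (1 - vecMulVec _ (Pi.single q 1))
  · simpa only [star_trivial] using
      posSemidef_vecMulVec_self_star (fun j => (σs ^ 2 + S q q)⁻¹ * S j q)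

theorem isDiag_covUpdate {n : ℕ} (σs : ℝ) (q : Fin n) {D : Matrix (Fin n) (Fin n) ℝ}
    (hD : D.IsDiag) : (covUpdate σs q D).IsDiag := by
  intro i j hij
  rw [covUpdate_apply, hD hij]
  rcases eq_or_ne i q with rfl | hi
  · simp [hD hij]
  · simp [hD hi]

theorem covUpdate_diag_le {n : ℕ} {σs : ℝ} (hσ : 0 < σs) (q : Fin n)
    {S D : Matrix (Fin n) (Fin n) ℝ} (hS : S.PosSemidef) (hD : D.IsDiag)
    (hle : ∀ i, S i i ≤ D i i) (i : Fin n) :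
    covUpdate σs q S i i ≤ covUpdate σs q D i i := by
  have hσ2 : 0 < σs ^ 2 := pow_pos hσ 2
  have hS0 : 0 ≤ S q q := hS.diag_nonneg
  have hq := hle q
  rw [covUpdate_apply, covUpdate_apply]
  rcases eq_or_ne i q with rfl | hi
  · have shrink {x : ℝ} (hx : 0 ≤ x) :
        x - (σs ^ 2 + x)⁻¹ * (x * x) = σs ^ 2 - σs ^ 2 * σs ^ 2 / (σs ^ 2 + x) := by
      have : σs ^ 2 + x ≠ 0 := by positivity
      field_simp
      ring
    rw [shrink hS0, shrink (hS0.trans hq)]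
    gcongr
  · have hsymm : S q i = S i q := by simpa using hS.1.apply i q
    have : 0 ≤ (σs ^ 2 + S q q)⁻¹ * (S i q * S q i) := by
      rw [hsymm]
      exact mul_nonneg (by positivity) (mul_self_nonneg _)
    rw [hD hi]
    linarith [hle i]

theorem correlated_vs_uncorrelated_priors
    (n : ℕ) (hn : 1 ≤ n) (σs : ℝ) (hσ : 0 < σs)
    (Sig0 : Matrix (Fin n) (Fin n) ℝ) (hSig0 : Sig0.PosSemidef)
    (T : ℕ) (idx : ℕ → Fin n)
    (S Sd : ℕ → Matrix (Fin n) (Fin n) ℝ)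
    (hS0 : S 0 = Sig0)
    (hSd0 : Sd 0 = Matrix.diagonal (fun i => Sig0 i i))
    (hS : ∀ t < T, S (t + 1) = covUpdate σs (idx (t + 1)) (S t))
    (hSd : ∀ t < T, Sd (t + 1) = covUpdate σs (idx (t + 1)) (Sd t)) :
    ∀ t ≤ T, ∀ i : Fin n, S t i i ≤ Sd t i i := by
  have key : ∀ t ≤ T, (S t).PosSemidef ∧ (Sd t).IsDiag ∧ ∀ i, S t i i ≤ Sd t i i := by
    intro t
    induction t with
    | zero =>
      intro _
      rw [hS0, hSd0]
      exact ⟨hSig0, isDiag_diagonal _, fun i => by simp⟩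
    | succ t ih =>
      intro ht
      obtain ⟨hP, hD, hle⟩ := ih (Nat.le_of_succ_le ht)
      rw [hS t ht, hSd t ht]
      exact ⟨posSemidef_covUpdate hσ _ hP, isDiag_covUpdate _ _ hD,
        covUpdate_diag_le hσ _ hP hD hle⟩
  exact fun t ht => (key t ht).2.2
end

section
/- For every integer k ≥ 1, setting b_k = ⌈2^{k−1}/k⌉, one has Σ_{r=1}^{b_k} k/(2^{k−1} + (r−1)·k) ≤ k/2^{k−1} + log 2. -/
open Real Finset

theorem sum_range_succ_div_add_mul_le {a d : ℝ} (ha : 0 < a) (hd : 0 ≤ d) (n : ℕ) :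
    ∑ r ∈ Finset.range (n + 1), d / (a + r * d) ≤ d / a + Real.log ((a + n * d) / a) := by
  induction n with
  | zero => simp [ha.ne']
  | succ n ih =>
    rw [Finset.sum_range_succ]
    have h₀ : 0 < a + n * d := by positivity
    have h₁ : 0 < a + (n + 1 : ℕ) * d := by positivity
    have h := Real.one_sub_inv_le_log_of_pos (div_pos h₁ h₀)
    have hlhs : 1 - ((a + (n + 1 : ℕ) * d) / (a + n * d))⁻¹ = d / (a + (n + 1 : ℕ) * d) := by
      rw [inv_div, eq_div_iff h₁.ne', sub_mul, div_mul_cancel₀ _ h₁.ne']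
      push_cast
      ring
    rw [hlhs, Real.log_div h₁.ne' h₀.ne'] at h
    rw [Real.log_div h₀.ne' ha.ne'] at ih
    rw [Real.log_div h₁.ne' ha.ne']
    linarith

theorem block_sum_bound (k : ℕ) (hk : 1 ≤ k) :
    ∑ r ∈ Finset.range ⌈(2 : ℝ) ^ (k - 1) / k⌉₊,
        (k : ℝ) / ((2 : ℝ) ^ (k - 1) + r * k) ≤
      (k : ℝ) / (2 : ℝ) ^ (k - 1) + Real.log 2 := by
  have hk₀ : (0 : ℝ) < k := by exact_mod_cast hk
  have ha : (0 : ℝ) < 2 ^ (k - 1) := by positivity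
  obtain ⟨n, hn⟩ := Nat.exists_eq_add_one.2 (Nat.ceil_pos.2 (div_pos ha hk₀))
  have hlt : (n : ℝ) < 2 ^ (k - 1) / k := Nat.lt_ceil.1 (by omega)
  rw [lt_div_iff₀ hk₀] at hlt
  rw [hn]
  refine (sum_range_succ_div_add_mul_le ha hk₀.le n).trans ?_
  gcongr
  rw [div_le_iff₀ ha]
  linarith
end
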